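/- arXiv:1708.03981 — 6 statements merged into one kernel-verified Lean document; each statement's English description precedes it below -/
import Mathlib

section
/- Let H_1, ..., H_M be n×n complex Hermitian matrices, let σ_1, ..., σ_M be positive reals, and let v ∈ ℂ^n. For each m define the vector g_m ∈ ℂ^{2n} obtained by stacking H_m v on top of (H_m)* v* (entrywise complex conjugates), and define the Fisher information matrix F := Σ_{m=1}^M σ_m^{-2} g_m g_m^H ∈ ℂ^{2n×2n}. Then the vector d ∈ ℂ^{2n} obtained by stacking v on top of −v* satisfies F d = 0. Consequently, if v ≠ 0 then F has a nontrivial null space (in particular F is not invertible, i.e., it has at least rank-one deficiency). -/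
open Matrix

theorem map_conj_mulVec_star {m n : Type*} [Fintype n]
    (A : Matrix m n ℂ) (v : n → ℂ) :
    (A.map (starRingEnd ℂ)).mulVec (star v) = star (A.mulVec v) := by
  ext i
  simp [Matrix.mulVec, dotProduct]

/-- For Hermitian `A`, the stacking of `A v` and its conjugate is orthogonal to the stacking of `v`
and `-v*`. -/
theorem star_stack_dotProduct_eq_zero {n : Type*} [Fintype n]
    {A : Matrix n n ℂ} (hA : A.IsHermitian) (v : n → ℂ) :
    star (Sum.elim (A.mulVec v) (star (A.mulVec v))) ⬝ᵥ Sum.elim v (-(star v)) = 0 := by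
  have h_star : star (Sum.elim (A.mulVec v) (star (A.mulVec v)))
      = Sum.elim (star (A.mulVec v)) (A.mulVec v) := by
    ext (i | i) <;> simp
  rw [h_star, sumElim_dotProduct_sumElim, star_mulVec, hA.eq, ← dotProduct_mulVec,
    dotProduct_neg, dotProduct_comm (A.mulVec v), add_neg_cancel]

/-- The Fisher information matrix `F = Σ_m σ_m⁻² g_m g_mᴴ`, with
`g_m` the stacking of `H_m v` on top of `(H_m)* v*`, annihilates the vector `d`
obtained by stacking `v` on top of `−v*`; hence for `v ≠ 0` the FIM has a
nontrivial null space and is not invertible (at least rank-one deficient). -/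
theorem fim_rank_deficient {n M : ℕ}
    (H : Fin M → Matrix (Fin n) (Fin n) ℂ)
    (hH : ∀ m, (H m).IsHermitian)
    (σ : Fin M → ℝ) (hσ : ∀ m, 0 < σ m)
    (v : Fin n → ℂ)
    (g : Fin M → (Fin n ⊕ Fin n) → ℂ)
    (hg : ∀ m, g m = Sum.elim ((H m).mulVec v)
      (((H m).map (starRingEnd ℂ)).mulVec (star v)))
    (F : Matrix (Fin n ⊕ Fin n) (Fin n ⊕ Fin n) ℂ)
    (hF : F = ∑ m, (((σ m) ^ 2)⁻¹ : ℝ) • Matrix.vecMulVec (g m) (star (g m)))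
    (d : (Fin n ⊕ Fin n) → ℂ)
    (hd : d = Sum.elim v (-(star v))) :
    F.mulVec d = 0 ∧
      (v ≠ 0 → (∃ x : (Fin n ⊕ Fin n) → ℂ, x ≠ 0 ∧ F.mulVec x = 0) ∧ ¬ IsUnit F) := by
  have hFd : F.mulVec d = 0 := by
    rw [hF, sum_mulVec]
    refine Finset.sum_eq_zero fun m _ => ?_
    rw [smul_mulVec, vecMulVec_mulVec, hg, hd, map_conj_mulVec_star,
      star_stack_dotProduct_eq_zero (hH m) v]
    simp
  refine ⟨hFd, fun hv => ?_⟩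
  have hd0 : d ≠ 0 := by
    intro h
    exact hv (funext fun i => by simpa [hd] using congrFun h (Sum.inl i))
  refine ⟨⟨d, hd0, hFd⟩, fun hU => hd0 ?_⟩
  exact mulVec_injective_of_isUnit hU (hFd.trans (mulVec_zero F).symm)
end

section
/- Let H be a real M×N matrix and z ∈ ℝ^M, and fix an index m. Let H_{(m)} and z_{(m)} denote H and z with the m-th row/entry deleted. Assume both HᵀH and H_{(m)}ᵀH_{(m)} are invertible. Define the full least-squares estimate v̂ := (HᵀH)^{-1}Hᵀz with residual r := z − H v̂, the leave-one-out estimate v̂_{(m)} := (H_{(m)}ᵀH_{(m)})^{-1}H_{(m)}ᵀ z_{(m)}, the a-priori error ô_m := z_m − h_mᵀ v̂_{(m)} (where h_mᵀ is the m-th row of H), and P := I_M − H(HᵀH)^{-1}Hᵀ. Then the a-posteriori residual satisfies r_m = P_{m,m} · ô_m. -/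
open Matrix

theorem transpose_mulVec_eq_submatrix_add {ι κ R : Type*} [Fintype ι] [DecidableEq ι]
    [CommSemiring R] (H : Matrix ι κ R) (y : ι → R) (m : ι) :
    Hᵀ *ᵥ y =
      (H.submatrix (Subtype.val : {i // i ≠ m} → ι) id)ᵀ *ᵥ (fun i => y i) + y m • H m := by
  ext j
  simp only [mulVec, dotProduct, transpose_apply, submatrix_apply, id, Pi.add_apply,
    Pi.smul_apply, smul_eq_mul]
  rw [Fintype.sum_eq_add_sum_subtype_ne _ m]
  ring

theorem transpose_mulVec_mulVec_leastSquares {ι κ R : Type*} [Fintype ι] [Fintype κ] [DecidableEq κ]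
    [CommRing R] (H : Matrix ι κ R) (h : IsUnit (Hᵀ * H)) (z : ι → R) :
    Hᵀ *ᵥ (H *ᵥ ((Hᵀ * H)⁻¹ *ᵥ (Hᵀ *ᵥ z))) = Hᵀ *ᵥ z := by
  rw [mulVec_mulVec, mulVec_mulVec, mul_nonsing_inv _ ((isUnit_iff_isUnit_det _).mp h),
    one_mulVec]

/-- A-posteriori vs a-priori error: with `v̂` the full least-squares estimate,
`v̂₍ₘ₎` the leave-one-out estimate omitting measurement `m`,
`ôₘ = zₘ − hₘᵀ v̂₍ₘ₎`, and `P = I − H(HᵀH)⁻¹Hᵀ`, the `m`-th residual of the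
full fit satisfies `rₘ = Pₘₘ ôₘ`. -/
theorem apost_apriori_residual {M N : ℕ}
    (H : Matrix (Fin M) (Fin N) ℝ) (z : Fin M → ℝ) (m : Fin M)
    (Hm : Matrix {i : Fin M // i ≠ m} (Fin N) ℝ)
    (hHm : Hm = Matrix.of fun i j => H i.1 j)
    (zm : {i : Fin M // i ≠ m} → ℝ)
    (hzm : zm = fun i => z i.1)
    (hinv : IsUnit (Hᵀ * H)) (hinvm : IsUnit (Hmᵀ * Hm))
    (vhat : Fin N → ℝ)
    (hvhat : vhat = (Hᵀ * H)⁻¹.mulVec (Hᵀ.mulVec z))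
    (r : Fin M → ℝ) (hr : r = z - H.mulVec vhat)
    (vhatm : Fin N → ℝ)
    (hvhatm : vhatm = (Hmᵀ * Hm)⁻¹.mulVec (Hmᵀ.mulVec zm))
    (ohat : ℝ) (hohat : ohat = z m - (fun j => H m j) ⬝ᵥ vhatm)
    (P : Matrix (Fin M) (Fin M) ℝ)
    (hP : P = 1 - H * (Hᵀ * H)⁻¹ * Hᵀ) :
    r m = P m m * ohat := by
  have hsub : Hm = H.submatrix Subtype.val id := hHm
  have hnormal : Hmᵀ *ᵥ (Hm *ᵥ vhatm) = Hmᵀ *ᵥ zm := by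
    rw [hvhatm]
    exact transpose_mulVec_mulVec_leastSquares Hm hinvm zm
  have hz := transpose_mulVec_eq_submatrix_add H z m
  have hw := transpose_mulVec_eq_submatrix_add H (H *ᵥ vhatm) m
  rw [← hsub] at hz hw
  have hrestrict : (fun i : {i // i ≠ m} => (H *ᵥ vhatm) i) = Hm *ᵥ vhatm := by
    subst hHm
    rfl
  rw [hrestrict, hnormal] at hw
  rw [← hzm] at hz
  have hohat' : ohat = z m - (H *ᵥ vhatm) m := hohat
  have hgram : Hᵀ *ᵥ z = (Hᵀ * H) *ᵥ vhatm + ohat • H m := by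
    rw [← mulVec_mulVec, hz, hw, hohat', sub_smul]
    abel
  have hupdate : vhat = vhatm + ohat • ((Hᵀ * H)⁻¹ *ᵥ H m) := by
    rw [hvhat, hgram, mulVec_add, mulVec_smul, mulVec_mulVec,
      nonsing_inv_mul _ ((isUnit_iff_isUnit_det _).mp hinv), one_mulVec]
  have hPmm : P m m = 1 - (H *ᵥ ((Hᵀ * H)⁻¹ *ᵥ H m)) m := by
    rw [hP, mulVec_mulVec, Matrix.sub_apply, one_apply_eq]
    rfl
  rw [hr, Pi.sub_apply, hupdate, mulVec_add, mulVec_smul, Pi.add_apply, Pi.smul_apply, hPmm,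
    hohat', smul_eq_mul]
  ring
end

section
/- Let H be a real M×N matrix and z ∈ ℝ^M, and fix an index m. Let H_{(m)} and z_{(m)} denote H and z with the m-th row/entry deleted. Assume both HᵀH and H_{(m)}ᵀH_{(m)} are invertible. Define v̂ := (HᵀH)^{-1}Hᵀz, r := z − H v̂, v̂_{(m)} := (H_{(m)}ᵀH_{(m)})^{-1}H_{(m)}ᵀ z_{(m)}, the leave-one-out residual r_{(m)} := z_{(m)} − H_{(m)} v̂_{(m)}, and the a-priori error ô_m := z_m − h_mᵀ v̂_{(m)} (where h_mᵀ is the m-th row of H). Then ‖r‖₂² = ‖r_{(m)}‖₂² + r_m · ô_m, where r_m is the m-th entry of r. -/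
open Matrix

/-- The least-squares residual is orthogonal to the column space, so pairing it with the residual
of any other estimate gives its squared norm. -/
theorem dotProduct_leastSquares_residual {ι κ : Type*} [Fintype ι] [Fintype κ] [DecidableEq κ]
    (A : Matrix ι κ ℝ) (y : ι → ℝ) (hA : IsUnit (Aᵀ * A)) (w : κ → ℝ) :
    (y - A *ᵥ w) ⬝ᵥ (y - A *ᵥ ((Aᵀ * A)⁻¹ *ᵥ (Aᵀ *ᵥ y))) =
      ∑ i, ((y - A *ᵥ ((Aᵀ * A)⁻¹ *ᵥ (Aᵀ *ᵥ y))) i) ^ 2 := by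
  set v := (Aᵀ * A)⁻¹ *ᵥ (Aᵀ *ᵥ y) with hv
  have normal : Aᵀ *ᵥ (y - A *ᵥ v) = 0 := by
    rw [mulVec_sub, mulVec_mulVec, hv, mulVec_mulVec,
      mul_nonsing_inv _ ((isUnit_iff_isUnit_det _).mp hA), one_mulVec, sub_self]
  have orth (u : κ → ℝ) : (A *ᵥ u) ⬝ᵥ (y - A *ᵥ v) = 0 := by
    rw [dotProduct_comm, dotProduct_mulVec, ← mulVec_transpose, normal, zero_dotProduct]
  have hsq : ∑ i, ((y - A *ᵥ v) i) ^ 2 = (y - A *ᵥ v) ⬝ᵥ (y - A *ᵥ v) := by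
    simp only [dotProduct, sq]
  rw [hsq, sub_dotProduct, sub_dotProduct y, orth, orth]

/-- Leave-one-out least-squares identity: `‖r‖₂² = ‖r₍ₘ₎‖₂² + rₘ ôₘ`, relating
the full residual `r`, the leave-one-out residual `r₍ₘ₎`, the `m`-th full
residual `rₘ`, and the a-priori error `ôₘ = zₘ − hₘᵀ v̂₍ₘ₎`. -/
theorem leave_one_out_residual_identity {M N : ℕ}
    (H : Matrix (Fin M) (Fin N) ℝ) (z : Fin M → ℝ) (m : Fin M)
    (Hm : Matrix {i : Fin M // i ≠ m} (Fin N) ℝ)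
    (hHm : Hm = Matrix.of fun i j => H i.1 j)
    (zm : {i : Fin M // i ≠ m} → ℝ)
    (hzm : zm = fun i => z i.1)
    (hinv : IsUnit (Hᵀ * H)) (hinvm : IsUnit (Hmᵀ * Hm))
    (vhat : Fin N → ℝ)
    (hvhat : vhat = (Hᵀ * H)⁻¹.mulVec (Hᵀ.mulVec z))
    (r : Fin M → ℝ) (hr : r = z - H.mulVec vhat)
    (vhatm : Fin N → ℝ)
    (hvhatm : vhatm = (Hmᵀ * Hm)⁻¹.mulVec (Hmᵀ.mulVec zm))
    (rm : {i : Fin M // i ≠ m} → ℝ)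
    (hrm : rm = zm - Hm.mulVec vhatm)
    (ohat : ℝ) (hohat : ohat = z m - (fun j => H m j) ⬝ᵥ vhatm) :
    ∑ i, (r i) ^ 2 = (∑ i, (rm i) ^ 2) + r m * ohat := by
  have full := dotProduct_leastSquares_residual H z hinv vhatm
  have deleted := dotProduct_leastSquares_residual Hm zm hinvm vhat
  rw [← hvhat, ← hr] at full
  rw [← hvhatm, ← hrm] at deleted
  rw [← full, ← deleted, dotProduct, Fintype.sum_eq_add_sum_subtype_ne _ m, add_comm]
  congr 1
  · refine Finset.sum_congr rfl fun i _ => ?_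
    subst hrm hr hHm hzm
    simp only [Pi.sub_apply, mulVec, of_apply]
    exact mul_comm _ _
  · rw [hohat, mul_comm]
    rfl
end

section
/- Let h be a function from ℂ^N (states) to ℝ^M (noiseless measurements), and let D ≥ 1 be an integer such that for all states v ≠ v', the Hamming distance between h(v) and h(v') (the number of entries in which they differ) is at least D. Then: (i) every attack vector o ∈ ℝ^M with at most D − 1 nonzero entries is observable, i.e., for every v there is no v' ≠ v with h(v) + o = h(v'); and (ii) if moreover there exist v₀ ≠ v₀' whose images achieve Hamming distance exactly D, then the attack o := h(v₀') − h(v₀) has exactly D nonzero entries and satisfies h(v₀) + o = h(v₀'), so it is not observable. Hence the maximum number of counterfeited meters for which every attack is guaranteed observable is K_o = D − 1. -/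
/-- Observable attacks: if every pair of distinct states has measurement
Hamming distance at least `D`, then (i) every attack with at most `D − 1`
nonzero entries is observable, and (ii) any attack realizing a Hamming
distance of exactly `D` between two states has exactly `D` nonzero entries and
is unobservable.  Hence `K_o = D − 1`. -/
theorem observable_attack_bound {N M : ℕ}
    (h : (Fin N → ℂ) → (Fin M → ℝ)) (D : ℕ) (hD : 1 ≤ D)
    (hdist : ∀ v v' : Fin N → ℂ, v ≠ v' →
      D ≤ Set.ncard {i | h v i ≠ h v' i}) :
    (∀ o : Fin M → ℝ, Set.ncard {i | o i ≠ 0} ≤ D - 1 →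
      ∀ v : Fin N → ℂ, ¬ ∃ v' : Fin N → ℂ, v' ≠ v ∧ h v + o = h v') ∧
    (∀ v₀ v₀' : Fin N → ℂ, v₀ ≠ v₀' →
      Set.ncard {i | h v₀ i ≠ h v₀' i} = D →
      Set.ncard {i | (h v₀' - h v₀) i ≠ 0} = D ∧
        h v₀ + (h v₀' - h v₀) = h v₀') := by
  refine ⟨?_, ?_⟩
  · rintro o ho v ⟨v', hne, hv⟩
    have hsupp : {i | h v i ≠ h v' i} = {i | o i ≠ 0} := by
      ext i
      simp [← hv]
    have hle := hdist v v' hne.symm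
    rw [hsupp] at hle
    omega
  · intro v₀ v₀' _ hcard
    refine ⟨?_, add_sub_cancel _ _⟩
    simpa only [Pi.sub_apply, sub_ne_zero, ne_comm] using hcard
end

section
/- Let h be a function from ℂ^N (states) to ℝ^M (noiseless measurements), and let D ≥ 1 be an integer such that for all states v ≠ v', the Hamming distance between h(v) and h(v') is at least D. Then every attack vector o ∈ ℝ^M with 2‖o‖₀ ≤ D − 1 (equivalently, ‖o‖₀ ≤ ⌊(D−1)/2⌋) is identifiable: for every state v, there is no pair (v', o') with v' ≠ v and ‖o'‖₀ ≤ ‖o‖₀ such that h(v) + o = h(v') + o'. -/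
/-- Identifiable attacks: if every pair of distinct states has measurement
Hamming distance at least `D`, then every attack `o` with `2‖o‖₀ ≤ D − 1`
is identifiable: for every state `v` there is no pair `(v', o')` with
`v' ≠ v` and `‖o'‖₀ ≤ ‖o‖₀` such that `h(v) + o = h(v') + o'`. -/
theorem identifiable_attack_bound {N M : ℕ}
    (h : (Fin N → ℂ) → (Fin M → ℝ)) (D : ℕ) (hD : 1 ≤ D)
    (hdist : ∀ v v' : Fin N → ℂ, v ≠ v' →
      D ≤ Set.ncard {i | h v i ≠ h v' i}) :
    ∀ o : Fin M → ℝ, 2 * Set.ncard {i | o i ≠ 0} ≤ D - 1 →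
      ∀ v : Fin N → ℂ,
        ¬ ∃ (v' : Fin N → ℂ) (o' : Fin M → ℝ), v' ≠ v ∧
          Set.ncard {i | o' i ≠ 0} ≤ Set.ncard {i | o i ≠ 0} ∧
          h v + o = h v' + o' := by
  rintro o ho v ⟨v', o', hv, hcard, heq⟩
  have hsub : {i | h v i ≠ h v' i} ⊆ {i | o i ≠ 0} ∪ {i | o' i ≠ 0} := by
    intro i hi
    by_contra hc
    simp only [Set.mem_union, Set.mem_ofPred_eq, not_or, not_not] at hc
    have hei := congrFun heq i
    simp only [Pi.add_apply, hc.1, hc.2, add_zero] at hei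
    exact hi hei
  have hle := Set.ncard_le_ncard hsub (Set.toFinite _)
  have hunion := Set.ncard_union_le {i | o i ≠ 0} {i | o' i ≠ 0}
  have hD' := hdist v v' hv.symm
  omega
end

section
/- Let H be a real M×N matrix with rank N (so the linear measurement map v ↦ Hv is injective), and suppose measurement m is critical: the matrix H_{(m)} obtained from H by deleting its m-th row has rank strictly less than N. Then there exist states v ≠ v' and an attack vector o ∈ ℝ^M with exactly one nonzero entry, located at position m, such that Hv + o = Hv'. In particular, the measurement distance of the linear map h(v) = Hv equals 1, and an attack corrupting only the single critical measurement m is unobservable. -/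
open Matrix

/-- A matrix over a field has full column rank iff `A *ᵥ x = 0` only for `x = 0`. -/
theorem Matrix.rank_eq_card_iff_mulVec_eq_zero {K m n : Type*} [Field K] [Fintype m] [Fintype n]
    (A : Matrix m n K) : A.rank = Fintype.card n ↔ ∀ x, A *ᵥ x = 0 → x = 0 := by
  have key := A.mulVecLin.finrank_range_add_finrank_ker
  rw [Module.finrank_fintype_fun_eq_card] at key
  change A.rank + _ = _ at key
  have hker : (∀ x, A *ᵥ x = 0 → x = 0) ↔ LinearMap.ker A.mulVecLin = ⊥ := by
    rw [LinearMap.ker_eq_bot']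
    rfl
  rw [hker, ← Submodule.finrank_eq_zero (R := K)]
  omega

/-- Critical measurements: if `H` has full column rank `N` but deleting its
`m`-th row destroys full column rank, then there exist distinct states `v ≠ v'`
and an attack `o` supported exactly on `{m}` with `Hv + o = Hv'`; in
particular the measurement distance of `v ↦ Hv` equals `1`. -/
theorem critical_measurement_unobservable_attack {M N : ℕ}
    (H : Matrix (Fin M) (Fin N) ℝ)
    (hrank : H.rank = N)
    (m : Fin M)
    (hcrit : (Matrix.of fun (i : {i : Fin M // i ≠ m}) j => H i.1 j).rank < N) :
    (∃ (v v' : Fin N → ℝ) (o : Fin M → ℝ),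
      v ≠ v' ∧ o m ≠ 0 ∧ (∀ i, i ≠ m → o i = 0) ∧
      H.mulVec v + o = H.mulVec v') ∧
    sInf {d : ℕ | ∃ w w' : Fin N → ℝ, w ≠ w' ∧
      d = Set.ncard {i | H.mulVec w i ≠ H.mulVec w' i}} = 1 := by
  have hinj : ∀ x, H *ᵥ x = 0 → x = 0 :=
    H.rank_eq_card_iff_mulVec_eq_zero.1 (by simpa using hrank)
  obtain ⟨x, hx, hx0⟩ : ∃ x : Fin N → ℝ, (∀ i, i ≠ m → (H *ᵥ x) i = 0) ∧ x ≠ 0 := by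
    by_contra! h
    refine hcrit.ne ?_
    rw [(Matrix.rank_eq_card_iff_mulVec_eq_zero _).2 fun x hx => h x fun i hi => ?_,
      Fintype.card_fin]
    exact congrFun hx ⟨i, hi⟩
  have hm : (H *ᵥ x) m ≠ 0 := fun h => hx0 <| hinj x <| funext fun i => by
    by_cases hi : i = m
    · exact hi ▸ h
    · exact hx i hi
  refine ⟨⟨0, x, H *ᵥ x, hx0.symm, hm, hx, by simp⟩, le_antisymm (Nat.sInf_le ?_) ?_⟩
  · refine ⟨x, 0, hx0, ?_⟩
    have hset : {i | (H *ᵥ x) i ≠ (H *ᵥ 0) i} = {m} := by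
      ext i
      simp only [mulVec_zero, Pi.zero_apply, Set.mem_ofPred_eq, Set.mem_singleton_iff]
      exact ⟨fun h => by_contra fun hi => h (hx i hi), fun h => h ▸ hm⟩
    rw [hset, Set.ncard_singleton]
  · refine le_csInf ⟨_, x, 0, hx0, rfl⟩ ?_
    rintro _ ⟨w, w', hw, rfl⟩
    refine (Set.ncard_pos (Set.toFinite _)).2 ?_
    by_contra! h
    refine hw (sub_eq_zero.1 (hinj _ ?_))
    rw [mulVec_sub, sub_eq_zero]
    ext i
    by_contra hi
    exact (h ▸ hi : i ∈ (∅ : Set (Fin M)))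
end
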